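/- (Fixed point theorem for maps not pointing outward along rays) Let Z be an affine subspace of ℝⁿ, K a compact convex subset of Z, and x̃ an interior point of K. Let φ : K → Z be continuous such that for every x ∈ ∂K, φ(x) ∉ Ext(x) := {x̃ + t(x - x̃) : t > 1}. Then φ has a fixed point in K. -/

import Mathlib

section

open Set Metric MeasureTheory Polynomial
open scoped Topology NNReal

/-- For an endomorphism `A` of a `d`-dimensional space, `det (1 + t A)` is a polynomial in `t` of
degree at most `d`. -/
theorem ContinuousLinearMap.exists_polynomial_eval_eq_det_one_add_smul
    {E : Type*} [NormedAddCommGroup E] [NormedSpace ℝ E] [FiniteDimensional ℝ E] (A : E →L[ℝ] E) :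
    ∃ p : ℝ[X], p.natDegree ≤ Module.finrank ℝ E ∧
      ∀ t : ℝ, p.eval t = (1 + t • A : E →L[ℝ] E).det := by
  classical
  let b := Module.finBasis ℝ E
  let M := LinearMap.toMatrix b b (A : E →ₗ[ℝ] E)
  refine ⟨((X : ℝ[X]) • M.map C + (1 : Matrix _ _ ℝ).map C).det, ?_, fun t ↦ ?_⟩
  · simpa using natDegree_det_X_add_C_le M 1
  · rw [ContinuousLinearMap.det, ← LinearMap.det_toMatrix b]
    have h : LinearMap.toMatrix b b ((1 + t • A : E →L[ℝ] E) : E →ₗ[ℝ] E) = 1 + t • M := by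
      rw [ContinuousLinearMap.toLinearMap_add, ContinuousLinearMap.toLinearMap_smul, map_add,
        map_smul]
      congr 1
      exact LinearMap.toMatrix_one b
    rw [h, ← coe_evalRingHom, RingHom.map_det]
    congr 1
    ext i j
    simp [Matrix.one_apply, apply_ite, add_comm, mul_comm t]

theorem ContinuousLinearMap.det_one_add_smul_pos
    {E : Type*} [NormedAddCommGroup E] [NormedSpace ℝ E] [FiniteDimensional ℝ E]
    {A : E →L[ℝ] E} {t : ℝ} (ht : 0 ≤ t) (hA : t * ‖A‖ < 1) :
    0 < (1 + t • A : E →L[ℝ] E).det := by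
  have hne : ∀ s ∈ Icc 0 t, (1 + s • A : E →L[ℝ] E).det ≠ 0 := by
    intro s hs h0
    obtain ⟨v, hv, hv0⟩ := Submodule.exists_mem_ne_zero_of_ne_bot
      (LinearMap.bot_lt_ker_of_det_eq_zero h0).ne'
    have h1 : v + s • A v = 0 := by simpa using hv
    have h2 : ‖v‖ ≤ s * (‖A‖ * ‖v‖) := by
      calc ‖v‖ = s * ‖A v‖ := by
            rw [← norm_neg, ← eq_neg_of_add_eq_zero_right h1, norm_smul, Real.norm_of_nonneg hs.1]
        _ ≤ s * (‖A‖ * ‖v‖) := mul_le_mul_of_nonneg_left (A.le_opNorm v) hs.1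
    have h3 : s * ‖A‖ < 1 := (mul_le_mul_of_nonneg_right hs.2 (norm_nonneg A)).trans_lt hA
    nlinarith [norm_pos_iff.mpr hv0]
  by_contra! hneg
  have hc : Continuous fun s : ℝ ↦ (1 + s • A : E →L[ℝ] E).det :=
    ContinuousLinearMap.continuous_det.comp (by fun_prop)
  obtain ⟨s, hs, h0⟩ := intermediate_value_Icc' ht hc.continuousOn
    ⟨hneg, by simp [ContinuousLinearMap.det]⟩
  exact hne s hs h0

/-- A function on a ball which vanishes on the sphere and is Lipschitz remains Lipschitz when
extended by zero. -/
theorem LipschitzOnWith.lipschitzWith_indicator_closedBall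
    {E F : Type*} [NormedAddCommGroup E] [NormedSpace ℝ E] [NormedAddCommGroup F]
    {g : E → F} {c : E} {r : ℝ} {L : ℝ≥0} (hg : LipschitzOnWith L g (closedBall c r))
    (h0 : ∀ x ∈ sphere c r, g x = 0) : LipschitzWith L ((closedBall c r).indicator g) := by
  have key : ∀ x ∈ closedBall c r, ∀ y ∉ closedBall c r, ‖g x‖ ≤ L * dist x y := by
    intro x hx y hy
    have hc : Continuous fun s : ℝ ↦ dist (AffineMap.lineMap x y s) c := by fun_prop
    obtain ⟨s, hs, hsr⟩ := intermediate_value_Icc (zero_le_one' ℝ) hc.continuousOn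
      (show r ∈ _ by simpa using ⟨hx, (not_le.mp hy).le⟩)
    have h1 := hg.dist_le_mul x hx _ (sphere_subset_closedBall hsr)
    rw [h0 _ hsr, dist_zero_right] at h1
    refine h1.trans (mul_le_mul_of_nonneg_left ?_ L.2)
    rw [dist_left_lineMap, Real.norm_of_nonneg hs.1]
    exact mul_le_of_le_one_left dist_nonneg hs.2
  refine LipschitzWith.of_dist_le_mul fun x y ↦ ?_
  by_cases hx : x ∈ closedBall c r <;> by_cases hy : y ∈ closedBall c r
  · simpa [hx, hy] using hg.dist_le_mul x hx y hy
  · simpa [indicator_of_mem hx, indicator_of_notMem hy] using key x hx y hy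
  · simpa [indicator_of_mem hy, indicator_of_notMem hx, dist_comm x] using key y hy x hx
  · simp only [indicator_of_notMem hx, indicator_of_notMem hy, dist_self]
    positivity

/-- A small Lipschitz perturbation of the identity is bijective. -/
theorem LipschitzWith.bijective_add_smul
    {E : Type*} [NormedAddCommGroup E] [NormedSpace ℝ E] [CompleteSpace E]
    {g : E → E} {L : ℝ≥0} (hg : LipschitzWith L g) {t : ℝ} (ht : 0 ≤ t) (htL : t * L < 1) :
    Function.Bijective fun x ↦ x + t • g x := by
  have ha : ApproximatesLinearOn (fun x ↦ x + t • g x) (ContinuousLinearEquiv.refl ℝ E : E →L[ℝ] E)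
      univ (t.toNNReal * L) := by
    intro x _ y _
    have h1 : x + t • g x - (y + t • g y) - (x - y) = t • (g x - g y) := by
      rw [smul_sub]; abel
    simp only [ContinuousLinearEquiv.coe_refl, ContinuousLinearMap.id_apply, h1, norm_smul,
      Real.norm_of_nonneg ht, NNReal.coe_mul, Real.coe_toNNReal t ht, mul_assoc]
    exact mul_le_mul_of_nonneg_left (hg.norm_sub_le x y) ht
  refine (ha.toHomeomorph _ ?_).bijective
  rcases subsingleton_or_nontrivial E with h | h
  · exact .inl h
  · right
    rw [← NNReal.coe_lt_coe]
    simpa [ht] using htL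

/-- For a `C¹` map `h` of a ball fixing the boundary sphere, the integral of the Jacobian over the
ball is its volume. -/
theorem ContDiff.integral_det_fderiv_eq_of_eqOn_sphere
    {E : Type*} [NormedAddCommGroup E] [NormedSpace ℝ E] [FiniteDimensional ℝ E]
    [MeasurableSpace E] [BorelSpace E] (μ : Measure E) [μ.IsAddHaarMeasure]
    {h : E → E} (hh : ContDiff ℝ 1 h) {r : ℝ} (hid : ∀ x ∈ sphere (0 : E) r, h x = x) :
    ∫ x in ball 0 r, (fderiv ℝ h x).det ∂μ = μ.real (ball 0 r) := by
  have hd := hh.differentiable one_ne_zero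
  let A : E → E →L[ℝ] E := fun x ↦ fderiv ℝ h x - 1
  have hA : Continuous A := (hh.continuous_fderiv one_ne_zero).sub continuous_const
  obtain ⟨L, hL⟩ := (hh.sub contDiff_id).contDiffOn.exists_lipschitzOnWith one_ne_zero
    (convex_closedBall (0 : E) r) (isCompact_closedBall 0 r)
  let g := (closedBall (0 : E) r).indicator (h - id)
  have hg : LipschitzWith L g := hL.lipschitzWith_indicator_closedBall fun x hx ↦ by
    simp [hid x hx]
  have hg_out : ∀ x ∉ ball (0 : E) r, g x = 0 := by
    intro x hx
    by_cases hx' : x ∈ closedBall (0 : E) r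
    · have : x ∈ sphere (0 : E) r := by
        rw [← closedBall_sdiff_ball]; exact ⟨hx', hx⟩
      simp [g, hx', hid x this]
    · exact indicator_of_notMem hx' _
  have hg_deriv : ∀ x ∈ ball (0 : E) r, HasFDerivAt g (A x) x := by
    intro x hx
    refine HasFDerivAt.congr_of_eventuallyEq ((hd x).hasFDerivAt.sub (hasFDerivAt_id x)) ?_
    filter_upwards [isOpen_ball.mem_nhds hx] with y hy
    simp [g, ball_subset_closedBall hy]
  have hAL : ∀ x ∈ ball (0 : E) r, ‖A x‖ ≤ L := fun x hx ↦
    (hg_deriv x hx).le_of_lipschitz hg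
  have hint : ∀ t : ℝ, IntegrableOn (fun x ↦ (1 + t • A x).det) (ball 0 r) μ := fun t ↦
    ((ContinuousLinearMap.continuous_det.comp (by fun_prop)).continuousOn.integrableOn_compact
      (isCompact_closedBall 0 r)).mono_set ball_subset_closedBall
  have hsmall : ∀ t : ℝ, 0 ≤ t → t * L < 1 →
      ∫ x in ball 0 r, (1 + t • A x).det ∂μ = μ.real (ball 0 r) := by
    intro t ht htL
    have hbij := hg.bijective_add_smul ht htL
    have him : (fun x ↦ x + t • g x) '' ball 0 r = ball 0 r := by
      have hc : (fun x ↦ x + t • g x) '' (ball 0 r)ᶜ = (ball 0 r)ᶜ := by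
        rw [image_congr (g := id) fun x hx ↦ by simp [hg_out x hx], image_id]
      rw [image_compl_eq hbij] at hc
      exact compl_injective hc
    have h1 := integral_image_eq_integral_abs_det_fderiv_smul μ
      (f := fun x ↦ x + t • g x) (f' := fun x ↦ 1 + t • A x) measurableSet_ball
      (fun x hx ↦ ((hasFDerivAt_id x).add ((hg_deriv x hx).const_smul t)).hasFDerivWithinAt)
      hbij.injective.injOn (fun _ ↦ (1 : ℝ))
    rw [him] at h1
    simp only [integral_const, smul_eq_mul, mul_one, measureReal_restrict_apply_univ] at h1
    rw [h1]
    refine setIntegral_congr_fun measurableSet_ball fun x hx ↦ (abs_of_pos ?_).symm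
    exact ContinuousLinearMap.det_one_add_smul_pos ht
      ((mul_le_mul_of_nonneg_left (hAL x hx) ht).trans_lt htL)
  -- Lagrange interpolation at small nodes transfers the identity from small `t` to `t = 1`.
  let d := Module.finrank ℝ E
  let v : ℕ → ℝ := fun i ↦ i / ((d + 1) * (L + 1))
  have hv : InjOn v (Finset.range (d + 1)) := by
    intro i _ j _ hij
    have : ((d + 1) * (L + 1) : ℝ) ≠ 0 := by positivity
    simpa [v, div_left_inj' this] using hij
  let ℓ : ℕ → ℝ := fun i ↦ (Lagrange.basis (Finset.range (d + 1)) v i).eval 1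
  have hℓ : ∑ i ∈ Finset.range (d + 1), ℓ i = 1 := by
    rw [← eval_finsetSum, Lagrange.sum_basis hv ⟨0, by simp⟩, eval_one]
  have hdet : ∀ x, (fderiv ℝ h x).det =
      ∑ i ∈ Finset.range (d + 1), (1 + v i • A x).det * ℓ i := by
    intro x
    obtain ⟨p, hp, hpe⟩ := (A x).exists_polynomial_eval_eq_det_one_add_smul
    have hdeg : p.degree < (Finset.range (d + 1)).card := by
      rw [Finset.card_range]
      exact degree_le_natDegree.trans_lt (by exact_mod_cast Nat.lt_succ_of_le hp)
    have h1 := congrArg (eval 1) (Lagrange.eq_interpolate hv hdeg)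
    rw [Lagrange.interpolate_apply, eval_finsetSum, hpe] at h1
    simpa [A, ℓ, hpe] using h1
  simp_rw [hdet]
  rw [integral_finsetSum _ fun i _ ↦ (hint _).mul_const _]
  simp_rw [integral_mul_const]
  have hvL : ∀ i ∈ Finset.range (d + 1), v i * L < 1 := by
    intro i hi
    have hi' : (i : ℝ) < d + 1 := by exact_mod_cast Finset.mem_range.mp hi
    rw [div_mul_eq_mul_div, div_lt_one (by positivity)]
    have : (0 : ℝ) ≤ L := L.2
    nlinarith [(i.cast_nonneg : (0 : ℝ) ≤ i)]
  rw [Finset.sum_congr rfl fun i hi ↦ by rw [hsmall (v i) (by positivity) (hvL i hi)],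
    ← Finset.mul_sum, hℓ, mul_one]

/-- There is no `C¹` retraction of a ball onto its boundary sphere. -/
theorem ContDiff.not_retraction_sphere
    {E : Type*} [NormedAddCommGroup E] [InnerProductSpace ℝ E] [FiniteDimensional ℝ E]
    {h : E → E} (hh : ContDiff ℝ 1 h) {r : ℝ} (hr : 0 < r)
    (hid : ∀ x ∈ sphere (0 : E) r, h x = x) (hnorm : ∀ x, ‖h x‖ = r) : False := by
  let : MeasurableSpace E := borel E
  have : BorelSpace E := ⟨rfl⟩
  have h1 := hh.integral_det_fderiv_eq_of_eqOn_sphere Measure.addHaar hid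
  have h2 : ∀ x, (fderiv ℝ h x).det = 0 := by
    intro x
    by_contra hdet
    have hx := ((hh.differentiable one_ne_zero) x).hasFDerivAt
    have hsurj : Function.Surjective (fderiv ℝ h x) :=
      (LinearMap.equivOfDetNeZero (fderiv ℝ h x : E →ₗ[ℝ] E) hdet).surjective
    obtain ⟨w, hw⟩ := hsurj (h x)
    have h3 := hx.norm_sq
    have h4 : (‖h ·‖ ^ 2) = fun _ ↦ r ^ 2 := by
      ext y; simp [hnorm]
    rw [h4] at h3
    have h5 := congrArg (fun T : E →L[ℝ] ℝ ↦ T w) (h3.unique (hasFDerivAt_const (r ^ 2) x))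
    simp [hw, hnorm, hr.ne'] at h5
  simp only [h2, integral_zero] at h1
  exact (ENNReal.toReal_pos (measure_ball_pos _ _ hr).ne' measure_ball_lt_top.ne).ne h1

/-- **Brouwer's fixed point theorem** for continuous self-maps of a Euclidean space with bounded
range. -/
theorem Continuous.exists_fixedPoint_of_norm_le
    {E : Type*} [NormedAddCommGroup E] [InnerProductSpace ℝ E] [FiniteDimensional ℝ E]
    {f : E → E} (hf : Continuous f) {R : ℝ} (hR : ∀ x, ‖f x‖ ≤ R) : ∃ x, f x = x := by
  by_contra! hne
  have hR0 : 0 ≤ R := (norm_nonneg _).trans (hR 0)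
  let χ : E → ℝ := fun x ↦ max 0 (min 1 (R + 1 - ‖x‖))
  have hχ0 : ∀ x, 0 ≤ χ x := fun x ↦ le_max_left _ _
  have hχ1 : ∀ x, χ x ≤ 1 := fun x ↦ max_le zero_le_one (min_le_left _ _)
  have hu : Continuous fun x ↦ χ x • f x := by fun_prop
  have hpos : ∀ x, 0 < ‖x - χ x • f x‖ := by
    intro x
    rw [norm_pos_iff, sub_ne_zero]
    intro hx
    have hxR : ‖x‖ ≤ R := by
      rw [hx, norm_smul, Real.norm_of_nonneg (hχ0 x)]
      exact (mul_le_of_le_one_left (norm_nonneg _) (hχ1 x)).trans (hR x)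
    have : χ x = 1 := by
      simp only [χ]
      rw [min_eq_left (by linarith), max_eq_right zero_le_one]
    rw [this, one_smul] at hx
    exact hne x hx.symm
  obtain ⟨g, hg, hgu, hgs⟩ := hu.exists_contDiff_approx 1
    (ε := fun x ↦ ‖x - χ x • f x‖) (by fun_prop) hpos
  have hg_ne : ∀ x, x - g x ≠ 0 := by
    intro x hx
    have := hgu x
    rw [← sub_eq_zero.mp hx, dist_eq_norm] at this
    exact this.false
  refine ContDiff.not_retraction_sphere (h := fun x ↦ ((R + 1) / ‖x - g x‖) • (x - g x)) (r := R + 1)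
    ?_ (by positivity) ?_ ?_
  · have h1 : ContDiff ℝ 1 fun x ↦ x - g x := contDiff_id.sub hg
    exact (contDiff_const.div (h1.norm ℝ hg_ne) fun x ↦ norm_ne_zero_iff.mpr (hg_ne x)).smul h1
  · intro x hx
    have hxn : ‖x‖ = R + 1 := by simpa using hx
    have hgx : g x = 0 := by
      by_contra h
      exact hgs h (by simp [χ, hxn])
    have : R + 1 ≠ 0 := by positivity
    simp [hgx, hxn, this]
  · intro x
    have := norm_ne_zero_iff.mpr (hg_ne x)
    rw [norm_smul, Real.norm_of_nonneg (by positivity)]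
    field_simp

/-- **Brouwer's fixed point theorem** for continuous self-maps of a finite-dimensional space whose
range lies in a compact set. -/
theorem Continuous.exists_fixedPoint_of_forall_mem_isCompact
    {V : Type*} [NormedAddCommGroup V] [NormedSpace ℝ V] [FiniteDimensional ℝ V]
    {f : V → V} (hf : Continuous f) {C : Set V} (hC : IsCompact C) (hfC : ∀ x, f x ∈ C) :
    ∃ x, f x = x := by
  let e := toEuclidean (E := V)
  obtain ⟨R, hR⟩ := (hC.image e.continuous).isBounded.exists_norm_le
  obtain ⟨x, hx⟩ := Continuous.exists_fixedPoint_of_norm_le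
    (f := fun x ↦ e (f (e.symm x))) (by fun_prop) (R := R)
    fun x ↦ hR _ (mem_image_of_mem _ (hfC _))
  exact ⟨e.symm x, e.injective (by simpa using hx)⟩

/-- A continuous map on a compact convex neighbourhood of the origin that sends no boundary point
strictly outward along its ray has a fixed point. -/
theorem IsCompact.exists_fixedPoint_of_forall_frontier_ne_smul
    {V : Type*} [NormedAddCommGroup V] [NormedSpace ℝ V] [FiniteDimensional ℝ V]
    {K : Set V} (hK : IsCompact K) (hconv : Convex ℝ K) (h0 : K ∈ 𝓝 0)
    {f : V → V} (hf : ContinuousOn f K)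
    (hout : ∀ x ∈ frontier K, ∀ t : ℝ, 1 < t → f x ≠ t • x) : ∃ x ∈ K, f x = x := by
  let m : V → ℝ := fun y ↦ max 1 (gauge K y)
  have hm : ∀ y, 0 < m y := fun y ↦ zero_lt_one.trans_le (le_max_left _ _)
  let p : V → V := fun y ↦ (m y)⁻¹ • y
  have hgp : ∀ y, gauge K (p y) = (m y)⁻¹ * gauge K y := fun y ↦
    gauge_smul_of_nonneg (inv_nonneg.mpr (hm y).le) y
  have hp : Continuous p :=
    ((continuous_const.max (continuous_gauge hconv h0)).inv₀ fun y ↦ (hm y).ne').smul continuous_id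
  have hpK : ∀ y, p y ∈ K := by
    intro y
    rw [← hK.isClosed.closure_eq, ← gauge_le_one_iff_mem_closure hconv h0, hgp,
      inv_mul_le_one₀ (hm y)]
    exact le_max_right _ _
  obtain ⟨z, hz⟩ := (hf.comp_continuous hp hpK).exists_fixedPoint_of_forall_mem_isCompact
    (hK.image_of_continuousOn hf) fun y ↦ mem_image_of_mem _ (hpK y)
  rw [Function.comp_apply] at hz
  rcases le_or_gt (gauge K z) 1 with h | h
  · have hpz : p z = z := by simp [p, m, max_eq_left h]
    exact ⟨z, hpz ▸ hpK z, by rwa [hpz] at hz⟩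
  · have hmz : m z = gauge K z := max_eq_right h.le
    refine absurd ?_ (hout (p z) ?_ (m z) (hmz ▸ h))
    · rw [hz, smul_inv_smul₀ (hm z).ne']
    · rw [← gauge_eq_one_iff_mem_frontier hconv h0, hgp, hmz, inv_mul_cancel₀ (by positivity)]

end

/-- Theorem 3.1: If `φ : K → Z` is continuous and for every
`x ∈ ∂K` we have `φ(x) ∉ Ext(x) = {x̃ + t (x - x̃) : t > 1}`, then `φ` has a
fixed point in `K`. -/
theorem fixed_point_of_non_outward_map
    (n : ℕ) (Z : AffineSubspace ℝ (Fin n → ℝ))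
    (K : Set Z) (hKc : IsCompact K) (hKconv : Convex ℝ (Subtype.val '' K))
    (xt : Z) (hxt : xt ∈ interior K)
    (φ : Z → Z) (hφc : ContinuousOn φ K)
    (hφ : ∀ x : Z, x ∈ frontier K →
      ¬ ∃ t : ℝ, 1 < t ∧
        (φ x : Fin n → ℝ) = (xt : Fin n → ℝ) + t • ((x : Fin n → ℝ) - (xt : Fin n → ℝ))) :
    ∃ x ∈ K, φ x = x := by
  classical
  have : Nonempty Z := ⟨xt⟩
  let e : Z.direction ≃ₜ Z := (AffineIsometryEquiv.vaddConst ℝ xt).toHomeomorph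
  have he : ∀ v, ((e v : Z) : Fin n → ℝ) = (v : Fin n → ℝ) + xt := fun v ↦ rfl
  have hes : ∀ x, ((e.symm x : Z.direction) : Fin n → ℝ) = (x : Fin n → ℝ) - xt := fun v ↦ rfl
  have he0 : e 0 = xt := Subtype.ext (by simp [he])
  suffices h : ∃ v ∈ e ⁻¹' K, e.symm (φ (e v)) = v by
    obtain ⟨v, hv, hfix⟩ := h
    exact ⟨e v, hv, e.symm_apply_eq.mp hfix⟩
  refine IsCompact.exists_fixedPoint_of_forall_frontier_ne_smul
    (e.isCompact_preimage.mpr hKc) ?_ ?_ ?_ ?_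
  · intro v hv w hw a b ha hb hab
    obtain ⟨y, hy, hy'⟩ := hKconv (Set.mem_image_of_mem _ hv) (Set.mem_image_of_mem _ hw) ha hb hab
    have : e (a • v + b • w) = y := by
      refine Subtype.ext ?_
      rw [hy', he, he, he]
      have h1 : (xt : Fin n → ℝ) = a • (xt : Fin n → ℝ) + b • (xt : Fin n → ℝ) := by
        rw [← add_smul, hab, one_smul]
      simp only [Submodule.coe_add, Submodule.coe_smul, smul_add]
      nth_rw 1 [h1]
      abel
    rw [Set.mem_preimage, this]
    exact hy
  · exact e.continuous.continuousAt.preimage_mem_nhds (he0.symm ▸ mem_interior_iff_mem_nhds.mp hxt)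
  · exact e.symm.continuous.comp_continuousOn
      (hφc.comp e.continuous.continuousOn (Set.mapsTo_preimage _ _))
  · intro v hv t ht h
    rw [← e.preimage_frontier] at hv
    refine hφ (e v) hv ⟨t, ht, ?_⟩
    have h1 := congrArg (Subtype.val) h
    rw [hes, Submodule.coe_smul, sub_eq_iff_eq_add] at h1
    rw [h1, he]
    simp [add_comm]
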